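/- Let G be a finite simple graph with no K_{2,3} minor and let ℓ ≥ 6 be an integer. Then for every pair of proper ℓ-colorings α and β of G there exists a transformation from α to β recoloring each vertex at most 3 times. -/

import Mathlib

open SimpleGraph

/-- A proper coloring of `G` with `ℓ` colors: adjacent vertices get distinct colors. -/
def IsProperColoring {V : Type} (G : SimpleGraph V) {ℓ : ℕ} (c : V → Fin ℓ) : Prop :=
  ∀ ⦃u v : V⦄, G.Adj u v → c u ≠ c v

/-- `c` is a transformation sequence from `α` to `β`: a sequence of proper colorings
starting at `α`, ending at `β`, in which consecutive colorings differ on exactly one vertex. -/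
def IsTransformSeq {V : Type} (G : SimpleGraph V) {ℓ m : ℕ}
    (c : Fin (m + 1) → V → Fin ℓ) (α β : V → Fin ℓ) : Prop :=
  c 0 = α ∧ c (Fin.last m) = β ∧ (∀ i, IsProperColoring G (c i)) ∧
    ∀ i : Fin m, ∃! v : V, c i.castSucc v ≠ c i.succ v

/-- The number of steps of the sequence `c` at which the vertex `v` is recolored. -/
def RecolorCount {V : Type} {ℓ m : ℕ} (c : Fin (m + 1) → V → Fin ℓ) (v : V) : ℕ :=
  (Finset.univ.filter fun i : Fin m => c i.castSucc v ≠ c i.succ v).card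

/-- `H` is a minor of `G`: there are pairwise disjoint nonempty branch sets in `G`, each
inducing a connected subgraph, with an edge of `G` between the branch sets of any two
vertices adjacent in `H`. -/
def IsMinor {W V : Type} (H : SimpleGraph W) (G : SimpleGraph V) : Prop :=
  ∃ B : W → Set V,
    (∀ h, (B h).Nonempty) ∧
    (Pairwise fun h h' => Disjoint (B h) (B h')) ∧
    (∀ h, (G.induce (B h)).Connected) ∧
    ∀ ⦃h h'⦄, H.Adj h h' → ∃ u ∈ B h, ∃ v ∈ B h', G.Adj u v

/-- `f 0, …, f k` is a path of `G` inside `S`. -/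
structure IsPathIn {V : Type} (G : SimpleGraph V) (S : Finset V) (f : ℕ → V) (k : ℕ) : Prop where
  mem : ∀ t ≤ k, f t ∈ S
  inj : ∀ s ≤ k, ∀ t ≤ k, f s = f t → s = t
  adj : ∀ t < k, G.Adj (f t) (f (t + 1))

namespace IsPathIn

variable {V : Type} {G : SimpleGraph V} {S : Finset V} {f : ℕ → V} {k : ℕ}

lemma length_lt_card (h : IsPathIn G S f k) : k < S.card := by
  have h1 : (Finset.range (k + 1)).card ≤ S.card :=
    Finset.card_le_card_of_injOn f
      (fun t ht => h.mem t (by have := Finset.mem_range.1 ht; omega))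
      (fun s hs t ht hst => h.inj s (by have := Finset.mem_range.1 hs; omega) t
        (by have := Finset.mem_range.1 ht; omega) hst)
  simpa using h1

lemma cons (h : IsPathIn G S f k) {w : V} (hw : w ∈ S) (hadj : G.Adj (f 0) w)
    (hne : ∀ t ≤ k, w ≠ f t) :
    IsPathIn G S (fun t => if t = 0 then w else f (t - 1)) (k + 1) where
  mem t ht := by
    split_ifs with h0
    · exact hw
    · exact h.mem _ (by omega)
  inj s hs t ht hst := by
    split_ifs at hst with h0 h1 h1
    · omega
    · exact absurd hst (hne _ (by omega))
    · exact absurd hst.symm (hne _ (by omega))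
    · have := h.inj _ (by omega) _ (by omega) hst
      omega
  adj t ht := by
    rcases Nat.eq_zero_or_pos t with rfl | h0
    · simpa using hadj.symm
    · have := h.adj (t - 1) (by omega)
      rw [Nat.sub_add_cancel h0] at this
      simpa [h0.ne'] using this

/-- Pósa rotation: reverse the part of the path before a neighbour `f i` of its first vertex. -/
lemma rotate (h : IsPathIn G S f k) {i : ℕ} (hi : 1 ≤ i) (hik : i ≤ k)
    (hadj : G.Adj (f 0) (f i)) :
    IsPathIn G S (fun t => if t < i then f (i - 1 - t) else f t) k where
  mem t ht := by
    split_ifs <;> exact h.mem _ (by omega)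
  inj s hs t ht hst := by
    split_ifs at hst <;>
    · have := h.inj _ (by omega) _ (by omega) hst
      omega
  adj t ht := by
    rcases lt_trichotomy (t + 1) i with h1 | h1 | h1
    · have := h.adj (i - 1 - (t + 1)) (by omega)
      rw [show i - 1 - (t + 1) + 1 = i - 1 - t by omega] at this
      rw [if_pos (by omega), if_pos h1]
      exact this.symm
    · subst h1
      simpa using hadj
    · rw [if_neg (by omega), if_neg (by omega)]
      exact h.adj t ht

lemma induce_image_Icc_connected (h : IsPathIn G S f k) {l r : ℕ} (hlr : l ≤ r) (hr : r ≤ k) :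
    (G.induce (f '' Set.Icc l r)).Connected := by
  have key : ∀ d, ∀ hd : l + d ≤ r, (G.induce (f '' Set.Icc l r)).Reachable
      ⟨f l, l, ⟨le_rfl, hlr⟩, rfl⟩ ⟨f (l + d), l + d, ⟨by omega, hd⟩, rfl⟩ := by
    intro d
    induction d with
    | zero => exact fun _ => SimpleGraph.Reachable.refl _
    | succ d ih =>
      intro hd
      refine (ih (by omega)).trans (SimpleGraph.Adj.reachable ?_)
      exact h.adj (l + d) (by omega)
  rw [SimpleGraph.connected_iff_exists_forall_reachable]
  refine ⟨⟨f l, l, ⟨le_rfl, hlr⟩, rfl⟩, ?_⟩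
  rintro ⟨_, t, ⟨h1, h2⟩, rfl⟩
  obtain ⟨d, rfl⟩ := Nat.exists_eq_add_of_le h1
  exact key d h2

/-- Two vertices of a path that both have neighbours in each of three disjoint segments of the
path form a `K_{2,3}` minor with these segments. -/
lemma isMinor_of_segments (h : IsPathIn G S f k) (p : Fin 2 → ℕ) (l r : Fin 3 → ℕ)
    (hp : ∀ a, p a ≤ k) (hp01 : p 0 ≠ p 1) (hlr : ∀ b, l b ≤ r b) (hr : ∀ b, r b ≤ k)
    (hpl : ∀ a b, p a < l b ∨ r b < p a)
    (hdisj : ∀ b b', b ≠ b' → r b < l b' ∨ r b' < l b)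
    (hadj : ∀ a b, ∃ s, l b ≤ s ∧ s ≤ r b ∧ G.Adj (f (p a)) (f s)) :
    IsMinor (completeBipartiteGraph (Fin 2) (Fin 3)) G := by
  let lo : Fin 2 ⊕ Fin 3 → ℕ := Sum.elim p l
  let hi : Fin 2 ⊕ Fin 3 → ℕ := Sum.elim p r
  have hlohi : ∀ x, lo x ≤ hi x := by
    rintro (a | b)
    · exact le_rfl
    · exact hlr b
  have hhi : ∀ x, hi x ≤ k := by
    rintro (a | b)
    · exact hp a
    · exact hr b
  have hsep : ∀ x y, x ≠ y → hi x < lo y ∨ hi y < lo x := by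
    rintro (a | b) (a' | b') hne
    · have : a ≠ a' := fun e => hne (by rw [e])
      simp only [lo, hi, Sum.elim_inl]
      fin_cases a <;> fin_cases a' <;> simp_all
      all_goals omega
    · exact hpl a b'
    · exact (hpl a' b).symm
    · exact hdisj b b' fun e => hne (by rw [e])
  refine ⟨fun x => f '' Set.Icc (lo x) (hi x),
    fun x => ⟨_, lo x, ⟨le_rfl, hlohi x⟩, rfl⟩, ?_,
    fun x => h.induce_image_Icc_connected (hlohi x) (hhi x), ?_⟩
  · intro x y hxy
    rw [Set.disjoint_left]
    rintro _ ⟨s, ⟨hs1, hs2⟩, rfl⟩ ⟨t, ⟨ht1, ht2⟩, hst⟩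
    have := h.inj t (ht2.trans (hhi y)) s (hs2.trans (hhi x)) hst
    rcases hsep x y hxy with h1 | h1 <;> omega
  · rintro (a | b) (a' | b') hxy
    · simp at hxy
    · obtain ⟨s, hs1, hs2, hs⟩ := hadj a b'
      exact ⟨_, ⟨p a, ⟨le_rfl, le_rfl⟩, rfl⟩, _, ⟨s, ⟨hs1, hs2⟩, rfl⟩, hs⟩
    · obtain ⟨s, hs1, hs2, hs⟩ := hadj a' b
      exact ⟨_, ⟨s, ⟨hs1, hs2⟩, rfl⟩, _, ⟨p a', ⟨le_rfl, le_rfl⟩, rfl⟩, hs.symm⟩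
    · simp at hxy

/-- If `f 0, f 1, f 2` form a triangle, `f 0` has a neighbour `f n` and `f 1` has a neighbour
`f m` with `3 ≤ m < n`, then there is a `K_{2,3}` minor. -/
lemma isMinor_of_lt (h : IsPathIn G S f k) (h02 : G.Adj (f 0) (f 2)) {m n : ℕ} (hm : 3 ≤ m)
    (hmn : m < n) (hn : n ≤ k) (h0n : G.Adj (f 0) (f n)) (h1m : G.Adj (f 1) (f m)) :
    IsMinor (completeBipartiteGraph (Fin 2) (Fin 3)) G := by
  have e1 := h.adj 0 (by omega)
  have e2 := h.adj (m - 1) (by omega)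
  rw [Nat.sub_add_cancel (by omega)] at e2
  have e3 := h.adj m (by omega)
  refine h.isMinor_of_segments ![0, m] ![1, 2, m + 1] ![1, m - 1, n] ?_ ?_ ?_ ?_ ?_ ?_ ?_
  · intro a; fin_cases a <;> simp; omega
  · simp; omega
  · intro b; fin_cases b <;> simp <;> omega
  · intro b; fin_cases b <;> simp <;> omega
  · intro a b; fin_cases a <;> fin_cases b <;> simp <;> omega
  · intro b b'; fin_cases b <;> fin_cases b' <;> simp <;> omega
  · intro a b
    fin_cases a <;> fin_cases b <;> dsimp
    · exact ⟨1, by simp, by simp, e1⟩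
    · exact ⟨2, by simp, by omega, h02⟩
    · exact ⟨n, by omega, by simp, h0n⟩
    · exact ⟨1, by simp, by simp, h1m.symm⟩
    · exact ⟨m - 1, by omega, by simp, e2.symm⟩
    · exact ⟨m + 1, by simp, by omega, e3⟩

lemma isMinor_of_four_le (h : IsPathIn G S f k) (h02 : G.Adj (f 0) (f 2)) {n : ℕ} (h4 : 4 ≤ n)
    (hn : n ≤ k) (h0n : G.Adj (f 0) (f n)) (h1n : G.Adj (f 1) (f n)) :
    IsMinor (completeBipartiteGraph (Fin 2) (Fin 3)) G := by
  have e1 := h.adj 1 (by omega)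
  have e2 := h.adj 2 (by omega)
  have e3 := h.adj (n - 1) (by omega)
  rw [Nat.sub_add_cancel (by omega)] at e3
  refine h.isMinor_of_segments ![2, n] ![0, 1, 3] ![0, 1, n - 1] ?_ ?_ ?_ ?_ ?_ ?_ ?_
  · intro a; fin_cases a <;> simp <;> omega
  · simp; omega
  · intro b; fin_cases b <;> simp; omega
  · intro b; fin_cases b <;> simp <;> omega
  · intro a b; fin_cases a <;> fin_cases b <;> simp <;> omega
  · intro b b'; fin_cases b <;> fin_cases b' <;> simp
  · intro a b
    fin_cases a <;> fin_cases b <;> dsimp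
    · exact ⟨0, by simp, by simp, h02.symm⟩
    · exact ⟨1, by simp, by simp, e1.symm⟩
    · exact ⟨3, by simp, by omega, e2⟩
    · exact ⟨0, by simp, by simp, h0n.symm⟩
    · exact ⟨1, by simp, by simp, h1n.symm⟩
    · exact ⟨n - 1, by omega, by simp, e3.symm⟩

lemma isMinor_of_crossing (h : IsPathIn G S f k) {i m n : ℕ} (hi : 3 ≤ i)
    (hm : i < m) (hmk : m ≤ k) (hn : i < n) (hnk : n ≤ k) (h0i : G.Adj (f 0) (f i))
    (h0n : G.Adj (f 0) (f n)) (him : G.Adj (f (i - 1)) (f m)) :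
    IsMinor (completeBipartiteGraph (Fin 2) (Fin 3)) G := by
  have e1 := h.adj 0 (by omega)
  have e2 := h.adj (i - 2) (by omega)
  rw [show i - 2 + 1 = i - 1 by omega] at e2
  have e3 := h.adj (i - 1) (by omega)
  rw [Nat.sub_add_cancel (by omega)] at e3
  refine h.isMinor_of_segments ![0, i - 1] ![1, i, min m n] ![i - 2, i, max m n]
    ?_ ?_ ?_ ?_ ?_ ?_ ?_
  · intro a; fin_cases a <;> simp; omega
  · simp; omega
  · intro b; fin_cases b <;> simp; omega
  · intro b; fin_cases b <;> simp <;> omega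
  · intro a b; fin_cases a <;> fin_cases b <;> simp <;> omega
  · intro b b'; fin_cases b <;> fin_cases b' <;> simp <;> omega
  · intro a b
    fin_cases a <;> fin_cases b <;> dsimp
    · exact ⟨1, by simp, by omega, e1⟩
    · exact ⟨i, by simp, by simp, h0i⟩
    · exact ⟨n, by simp, by simp, h0n⟩
    · exact ⟨i - 2, by omega, by simp, e2.symm⟩
    · exact ⟨i, by simp, by simp, e3⟩
    · exact ⟨m, by simp, by simp, him⟩

end IsPathIn

/-- A `K_{2,3}`-minor-free graph in which every vertex has at least three neighbours contains a
triangle `abc` all of whose outside neighbours coincide. -/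
lemma exists_pendant_triangle {V : Type} {G : SimpleGraph V}
    (hG : ¬ IsMinor (completeBipartiteGraph (Fin 2) (Fin 3)) G) {S : Finset V} (hS : S.Nonempty)
    (hdeg : ∀ v ∈ S, ∀ p q, ∃ w ∈ S, G.Adj v w ∧ w ≠ p ∧ w ≠ q) :
    ∃ a ∈ S, ∃ b ∈ S, ∃ c ∈ S, ∃ x ∈ S, G.Adj a b ∧ G.Adj a c ∧ G.Adj b c ∧
      G.Adj a x ∧ G.Adj b x ∧ G.Adj c x ∧
      (∀ w ∈ S, G.Adj a w → w = b ∨ w = c ∨ w = x) ∧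
      (∀ w ∈ S, G.Adj b w → w = a ∨ w = c ∨ w = x) ∧
      (∀ w ∈ S, G.Adj c w → w = a ∨ w = b ∨ w = x) := by
  classical
  obtain ⟨k, ⟨f₀, hf₀⟩, hmax⟩ : ∃ k, (∃ f, IsPathIn G S f k) ∧ ∀ f, ¬ IsPathIn G S f (k + 1) := by
    by_contra! hcon
    obtain ⟨v, hv⟩ := hS
    have : ∀ k, ∃ f, IsPathIn G S f k := by
      intro k
      induction k with
      | zero => exact ⟨fun _ => v, fun _ _ => hv, by intros; omega, by intros; omega⟩
      | succ k ih => exact hcon k ih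
    obtain ⟨f, hf⟩ := this S.card
    exact lt_irrefl _ hf.length_lt_card
  have hend : ∀ f, IsPathIn G S f k → ∀ w ∈ S, G.Adj (f 0) w → ∃ t ≤ k, 1 ≤ t ∧ w = f t := by
    intro f hf w hw hadj
    by_contra! hcon
    refine hmax _ (hf.cons hw hadj fun t ht => ?_)
    rcases Nat.eq_zero_or_pos t with rfl | h0
    · exact hadj.ne'
    · exact hcon t ht h0
  have hthird : ∀ f, IsPathIn G S f k → ∀ i, ∃ t ≤ k, 2 ≤ t ∧ t ≠ i ∧ G.Adj (f 0) (f t) := by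
    intro f hf i
    obtain ⟨w, hw, hadj, h1, h2⟩ := hdeg (f 0) (hf.mem 0 (Nat.zero_le _)) (f 1) (f i)
    obtain ⟨t, htk, ht1, rfl⟩ := hend f hf w hw hadj
    refine ⟨t, htk, ?_, fun e => h2 (by rw [e]), hadj⟩
    have : t ≠ 1 := fun e => h1 (by rw [e])
    omega
  have htri : ∃ f, IsPathIn G S f k ∧ G.Adj (f 0) (f 2) := by
    have hex : ∃ i, 2 ≤ i ∧ i ≤ k ∧ ∃ f, IsPathIn G S f k ∧ G.Adj (f 0) (f i) := by
      obtain ⟨t, h1, h2, -, h3⟩ := hthird f₀ hf₀ 0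
      exact ⟨t, h2, h1, f₀, hf₀, h3⟩
    obtain ⟨hi2, hik, f, hf, hadj⟩ := Nat.find_spec hex
    have hmin : ∀ j, 2 ≤ j → j ≤ k → ∀ g, IsPathIn G S g k → G.Adj (g 0) (g j) →
        Nat.find hex ≤ j := fun j h1 h2 g hg h3 => Nat.find_min' hex ⟨h1, h2, g, hg, h3⟩
    generalize Nat.find hex = i at *
    rcases hi2.eq_or_lt with rfl | hi3
    · exact ⟨f, hf, hadj⟩
    exfalso
    obtain ⟨n, hnk, hn2, hni, hn⟩ := hthird f hf i
    have := hmin n hn2 hnk f hf hn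
    have hr := hf.rotate (by omega) hik hadj
    obtain ⟨m, hmk, hm2, hmi, hm⟩ := hthird _ hr i
    have := hmin m hm2 hmk _ hr hm
    rw [if_pos (by omega), if_neg (by omega)] at hm
    exact hG (hf.isMinor_of_crossing hi3 (by omega : i < m) hmk (by omega) hnk hadj hn hm)
  obtain ⟨f, hf, h02⟩ := htri
  have main : ∀ f, IsPathIn G S f k → G.Adj (f 0) (f 2) →
      3 ≤ k ∧ G.Adj (f 0) (f 3) ∧ ∀ w ∈ S, G.Adj (f 0) w → w = f 1 ∨ w = f 2 ∨ w = f 3 := by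
    intro f hf h02
    obtain ⟨t, htk, ht2, -, -⟩ := hthird f hf 0
    have hr := hf.rotate (i := 2) (by omega) (by omega) h02
    obtain ⟨m, hmk, hm2, hmi, hm⟩ := hthird _ hr 2
    have hm' := hm
    rw [if_pos (by omega), if_neg (by omega)] at hm
    have h12 := hf.adj 1 (by omega)
    have huniq : ∀ n, 3 ≤ n → n ≤ k → G.Adj (f 0) (f n) → n = 3 ∧ m = 3 := by
      intro n hn3 hnk hn
      rcases lt_trichotomy m n with h | h | h
      · exact absurd (hf.isMinor_of_lt h02 (by omega) h hnk hn hm) hG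
      · subst h
        by_contra hne
        exact hG (hf.isMinor_of_four_le h02 (by omega) hnk hn hm)
      · refine absurd (hr.isMinor_of_lt (by simpa using h12) hn3 h hmk hm' ?_) hG
        rw [if_pos (by omega), if_neg (by omega)]
        exact hn
    obtain ⟨n, hnk, hn2, hne, hn⟩ := hthird f hf 2
    obtain ⟨rfl, -⟩ := huniq n (by omega) hnk hn
    refine ⟨hnk, hn, fun w hw hadj => ?_⟩
    obtain ⟨t, htk, ht1, rfl⟩ := hend f hf w hw hadj
    by_cases h3 : 3 ≤ t
    · rw [(huniq t h3 htk hadj).1]; simp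
    · obtain rfl | rfl : t = 1 ∨ t = 2 := by omega
      all_goals simp
  obtain ⟨hk, h03, hN0⟩ := main f hf h02
  have h01 := hf.adj 0 (by omega)
  have h12 := hf.adj 1 (by omega)
  obtain ⟨-, h13, hN1⟩ := main _ (hf.rotate (i := 2) (by omega) (by omega) h02) (by simpa using h12)
  obtain ⟨-, h23, hN2⟩ :=
    main _ (hf.rotate (i := 3) (by omega) hk h03) (by simpa using h02.symm)
  simp only [Nat.reduceSub, Nat.reduceLT, if_true, if_false] at hN1 hN2
  refine ⟨f 0, hf.mem _ (by omega), f 1, hf.mem _ (by omega), f 2, hf.mem _ (by omega), f 3,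
    hf.mem _ hk, h01, h02, h12, h03, by simpa using h13, by simpa using h23, hN0, ?_, ?_⟩
  · simpa using hN1
  · intro w hw h
    have := hN2 w hw (by simpa using h)
    tauto

section Recoloring

variable {V : Type} {ℓ : ℕ} {G : SimpleGraph V} {S S' : Finset V} {β c : V → Fin ℓ}

/-- `c` is a proper coloring of the subgraph of `G` induced by `S`. -/
def ProperOn (G : SimpleGraph V) (S : Finset V) (c : V → Fin ℓ) : Prop :=
  ∀ v ∈ S, ∀ w ∈ S, G.Adj v w → c v ≠ c w

lemma ProperOn.mono (h : ProperOn G S c) (hS : S' ⊆ S) : ProperOn G S' c :=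
  fun v hv w hw => h v (hS hv) w (hS hw)

/-- The successive colors given by `L` to the vertices satisfying `P`. -/
def newColors (P : V → Prop) [DecidablePred P] (L : List (V × Fin ℓ)) : List (Fin ℓ) :=
  (L.filter fun m => P m.1).map Prod.snd

@[simp] lemma newColors_nil (P : V → Prop) [DecidablePred P] :
    newColors P ([] : List (V × Fin ℓ)) = [] := rfl

lemma newColors_cons (P : V → Prop) [DecidablePred P] (m : V × Fin ℓ) (L : List (V × Fin ℓ)) :
    newColors P (m :: L) = if P m.1 then m.2 :: newColors P L else newColors P L := by
  by_cases h : P m.1 <;> simp [newColors, h]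

lemma exists_notMem_of_length_lt (l : List (Fin ℓ)) (h : l.length < ℓ) : ∃ k, k ∉ l := by
  by_contra! hcon
  have h1 : l.toFinset = Finset.univ := Finset.eq_univ_iff_forall.2 fun k => by simpa using hcon k
  have h2 := l.toFinset_card_le
  rw [h1, Finset.card_univ, Fintype.card_fin] at h2
  omega

/-- The vertices `a, b, d` of the triangle are added to `S'` to form `S`, and `x ∈ S'` is their
only possible neighbour in `S'`. -/
structure IsPendantTriangle (G : SimpleGraph V) (S' S : Finset V) (a b d x : V) : Prop where
  adj_ab : G.Adj a b
  adj_ad : G.Adj a d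
  adj_bd : G.Adj b d
  adj_ax : G.Adj a x
  adj_bx : G.Adj b x
  adj_dx : G.Adj d x
  subset : S' ⊆ S
  mem_S : ∀ w, w ∈ S ↔ w = a ∨ w = b ∨ w = d ∨ w ∈ S'
  ha : a ∉ S'
  hb : b ∉ S'
  hd : d ∉ S'
  hx : x ∈ S'
  nbr_a : ∀ w ∈ S, G.Adj a w → w = b ∨ w = d ∨ w = x
  nbr_b : ∀ w ∈ S, G.Adj b w → w = a ∨ w = d ∨ w = x
  nbr_d : ∀ w ∈ S, G.Adj d w → w = a ∨ w = b ∨ w = x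

namespace IsPendantTriangle

variable {a b d x : V}

lemma swap (h : IsPendantTriangle G S' S a b d x) : IsPendantTriangle G S' S b a d x where
  adj_ab := h.adj_ab.symm
  adj_ad := h.adj_bd
  adj_bd := h.adj_ad
  adj_ax := h.adj_bx
  adj_bx := h.adj_ax
  adj_dx := h.adj_dx
  subset := h.subset
  mem_S w := by rw [h.mem_S]; tauto
  ha := h.hb
  hb := h.ha
  hd := h.hd
  hx := h.hx
  nbr_a := h.nbr_b
  nbr_b := h.nbr_a
  nbr_d w hw hadj := by have := h.nbr_d w hw hadj; tauto

lemma swap' (h : IsPendantTriangle G S' S a b d x) : IsPendantTriangle G S' S a d b x where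
  adj_ab := h.adj_ad
  adj_ad := h.adj_ab
  adj_bd := h.adj_bd.symm
  adj_ax := h.adj_ax
  adj_bx := h.adj_dx
  adj_dx := h.adj_bx
  subset := h.subset
  mem_S w := by rw [h.mem_S]; tauto
  ha := h.ha
  hb := h.hd
  hd := h.hb
  hx := h.hx
  nbr_a w hw hadj := by have := h.nbr_a w hw hadj; tauto
  nbr_b := h.nbr_d
  nbr_d := h.nbr_b

lemma mem_a (h : IsPendantTriangle G S' S a b d x) : a ∈ S := (h.mem_S a).2 (by simp)

lemma mem_x (h : IsPendantTriangle G S' S a b d x) : x ∈ S := h.subset h.hx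

lemma a_ne_x (h : IsPendantTriangle G S' S a b d x) : a ≠ x := h.adj_ax.ne

lemma pairwise_ne (h : IsPendantTriangle G S' S a b d x) (hc : ProperOn G S c) :
    c a ≠ c b ∧ c a ≠ c d ∧ c b ≠ c d ∧ c a ≠ c x ∧ c b ≠ c x ∧ c d ≠ c x :=
  ⟨hc _ h.mem_a _ h.swap.mem_a h.adj_ab, hc _ h.mem_a _ h.swap'.swap.mem_a h.adj_ad,
    hc _ h.swap.mem_a _ h.swap'.swap.mem_a h.adj_bd, hc _ h.mem_a _ h.mem_x h.adj_ax,
    hc _ h.swap.mem_a _ h.mem_x h.adj_bx, hc _ h.swap'.swap.mem_a _ h.mem_x h.adj_dx⟩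

lemma color_ne (h : IsPendantTriangle G S' S a b d x) {k : Fin ℓ} (h1 : c b ≠ k) (h2 : c d ≠ k)
    (h3 : c x ≠ k) : ∀ w ∈ S, G.Adj a w → c w ≠ k := by
  intro w hw hadj
  rcases h.nbr_a w hw hadj with rfl | rfl | rfl <;> assumption

lemma exists_rotation (h : IsPendantTriangle G S' S a b d x) {v : V}
    (hv : v = a ∨ v = b ∨ v = d) :
    ∃ b' d', IsPendantTriangle G S' S v b' d' x ∧
      ∀ w, (w = v ∨ w = b' ∨ w = d') ↔ (w = a ∨ w = b ∨ w = d) := by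
  rcases hv with rfl | rfl | rfl
  · exact ⟨b, d, h, fun w => Iff.rfl⟩
  · exact ⟨a, d, h.swap, fun w => by tauto⟩
  · exact ⟨a, b, h.swap'.swap, fun w => by tauto⟩

lemma notMem_of_eq (h : IsPendantTriangle G S' S a b d x) {v : V}
    (hv : v = a ∨ v = b ∨ v = d) : v ∉ S' := by
  rcases hv with rfl | rfl | rfl
  exacts [h.ha, h.hb, h.hd]

end IsPendantTriangle

variable [DecidableEq V]

/-- Performing the list `L` of recolorings (possibly without effect) one after another, starting
at `c`, keeps the coloring proper on `S` and ends at `β` on `S`. -/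
def RecolorsOn (G : SimpleGraph V) (S : Finset V) (β : V → Fin ℓ) :
    List (V × Fin ℓ) → (V → Fin ℓ) → Prop
  | [], c => ∀ v ∈ S, c v = β v
  | m :: L, c => m.1 ∈ S ∧ (∀ w ∈ S, G.Adj m.1 w → c w ≠ m.2) ∧
      RecolorsOn G S β L (Function.update c m.1 m.2)

/-- The number of recolorings of `v` in `L`. -/
def moveCount (v : V) (L : List (V × Fin ℓ)) : ℕ := (L.map Prod.fst).count v

@[simp] lemma moveCount_nil (v : V) : moveCount v ([] : List (V × Fin ℓ)) = 0 := rfl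

@[simp] lemma moveCount_cons (v : V) (m : V × Fin ℓ) (L : List (V × Fin ℓ)) :
    moveCount v (m :: L) = moveCount v L + if m.1 = v then 1 else 0 := by
  simp [moveCount, List.count_cons]

lemma length_newColors_eq (x : V) (L : List (V × Fin ℓ)) :
    (newColors (· = x) L).length = moveCount x L := by
  induction L with
  | nil => rfl
  | cons m L ih => rw [newColors_cons, moveCount_cons, ← ih]; split_ifs <;> simp

lemma ProperOn.update (h : ProperOn G S c) {v : V} {k : Fin ℓ}
    (hk : ∀ w ∈ S, G.Adj v w → c w ≠ k) : ProperOn G S (Function.update c v k) := by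
  intro u hu w hw hadj
  by_cases h1 : u = v <;> by_cases h2 : w = v
  · subst h1 h2; exact absurd hadj (G.loopless.irrefl _)
  · subst h1; simpa [h2] using (hk w hw hadj).symm
  · subst h2; simpa [h1] using hk u hu hadj.symm
  · simpa [h1, h2] using h u hu w hw hadj

lemma RecolorsOn.congr {L : List (V × Fin ℓ)} {c c' : V → Fin ℓ} (h : RecolorsOn G S β L c)
    (hc : ∀ v ∈ S, c v = c' v) : RecolorsOn G S β L c' := by
  induction L generalizing c c' with
  | nil => exact fun v hv => (hc v hv).symm.trans (h v hv)
  | cons m L ih =>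
    obtain ⟨h1, h2, h3⟩ := h
    refine ⟨h1, fun w hw hadj => hc w hw ▸ h2 w hw hadj, ih h3 fun v hv => ?_⟩
    by_cases e : v = m.1
    · subst e; simp
    · simp [e, hc v hv]

/-- A vertex with at most two neighbours can follow a recoloring of the other vertices: each of
its own recolorings avoids the next three colors appearing in its neighbourhood. -/
lemma exists_recolorsOn_insert [DecidableRel G.Adj] (hℓ : 6 ≤ ℓ) {v : V} (hv : v ∉ S) {p q : V}
    (hN : ∀ w ∈ S, G.Adj v w → w = p ∨ w = q) (hβ : ProperOn G (insert v S) β)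
    (L : List (V × Fin ℓ)) (c : V → Fin ℓ) (r : ℕ) (hL : RecolorsOn G S β L c)
    (hc : ProperOn G (insert v S) c) (hr : c v ∉ (newColors (G.Adj v) L).take r) :
    ∃ L', RecolorsOn G (insert v S) β L' c ∧ (∀ w ≠ v, moveCount w L' = moveCount w L) ∧
      3 * moveCount v L' ≤ ((newColors (G.Adj v) L).length - r) + 5 := by
  induction L generalizing c r with
  | nil =>
    refine ⟨[(v, β v)], ⟨by simp, ?_, ?_⟩, fun w hw => by simp [hw.symm], by simp⟩
    · intro w hw hadj
      have hwS : w ∈ S := (Finset.mem_insert.1 hw).resolve_left hadj.ne'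
      rw [hL w hwS]
      exact (hβ v (by simp) w hw hadj).symm
    · intro w hw
      by_cases e : w = v
      · subst e; simp
      · simpa [e] using hL w ((Finset.mem_insert.1 hw).resolve_left e)
  | cons m L ih =>
    obtain ⟨w, k⟩ := m
    obtain ⟨hw, hk, hL⟩ := hL
    dsimp only at hw hk hL
    have hwv : w ≠ v := fun e => hv (e ▸ hw)
    rw [newColors_cons] at hr ⊢
    -- a recoloring of `w` that is also possible in the larger graph
    have keep : ∀ r', (∀ u ∈ insert v S, G.Adj w u → c u ≠ k) →
        c v ∉ (newColors (G.Adj v) L).take r' →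
        ∃ L', RecolorsOn G (insert v S) β L' c ∧
          (∀ u ≠ v, moveCount u L' = moveCount u ((w, k) :: L)) ∧
          3 * moveCount v L' ≤ ((newColors (G.Adj v) L).length - r') + 5 := by
      intro r' hk' hr'
      obtain ⟨L', h1, h2, h3⟩ := ih (Function.update c w k) r' hL (hc.update hk')
        (by rwa [Function.update_of_ne hwv.symm])
      refine ⟨(w, k) :: L', ⟨by simp [hw], hk', h1⟩, fun u hu => by simp [h2 u hu], ?_⟩
      simpa [hwv] using h3
    by_cases hadj : G.Adj v w
    · rw [if_pos hadj] at hr ⊢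
      by_cases hcv : c v = k
      · obtain rfl : r = 0 := by
          by_contra h0
          obtain ⟨r, rfl⟩ := Nat.exists_eq_succ_of_ne_zero h0
          simp [hcv] at hr
        obtain ⟨k', hk'⟩ := exists_notMem_of_length_lt
          (c p :: c q :: k :: (newColors (G.Adj v) L).take 2)
          (by simp only [List.length_cons, List.length_take]; omega)
        simp only [List.mem_cons, not_or] at hk'
        obtain ⟨hp, hq, hk'k, hk'L⟩ := hk'
        have hfree : ∀ u ∈ insert v S, G.Adj v u → c u ≠ k' := by
          intro u hu huv
          rcases hN u ((Finset.mem_insert.1 hu).resolve_left huv.ne') huv with rfl | rfl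
          · exact Ne.symm hp
          · exact Ne.symm hq
        have hfree' : ∀ u ∈ insert v S, G.Adj w u → Function.update c v k' u ≠ k := by
          intro u hu hwu
          by_cases e : u = v
          · subst e; simpa using hk'k
          · simpa [e] using hk u ((Finset.mem_insert.1 hu).resolve_left e) hwu
        obtain ⟨L', h1, h2, h3⟩ := ih (Function.update (Function.update c v k') w k) 2
          (hL.congr fun u hu => by
            have : u ≠ v := fun e => hv (e ▸ hu)
            rw [Function.update_comm hwv.symm, Function.update_of_ne this])
          ((hc.update hfree).update hfree')
          (by simpa [Function.update_of_ne hwv.symm] using hk'L)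
        refine ⟨(v, k') :: (w, k) :: L', ⟨by simp, hfree, by simp [hw], hfree', h1⟩,
          fun u hu => by simp [h2 u hu, hu.symm], ?_⟩
        simp only [moveCount_cons, if_neg hwv, List.length_cons]
        simp only [if_true]
        omega
      · obtain ⟨L', h1, h2, h3⟩ := keep (r - 1)
          (fun u hu hwu => by
            by_cases e : u = v
            · subst e; exact hcv
            · exact hk u ((Finset.mem_insert.1 hu).resolve_left e) hwu)
          (by
            cases r with
            | zero => simp
            | succ r => simp at hr; simpa using hr.2)
        refine ⟨L', h1, h2, ?_⟩
        rw [List.length_cons]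
        omega
    · rw [if_neg hadj] at hr ⊢
      refine keep r (fun u hu hwu => ?_) hr
      by_cases e : u = v
      · subst e; exact absurd hwu.symm hadj
      · exact hk u ((Finset.mem_insert.1 hu).resolve_left e) hwu

namespace IsPendantTriangle

variable {a b d x : V}

lemma recolorsOn_cons (h : IsPendantTriangle G S' S a b d x) {k : Fin ℓ} (h1 : c b ≠ k)
    (h2 : c d ≠ k) (h3 : c x ≠ k) {L : List (V × Fin ℓ)}
    (hL : RecolorsOn G S β L (Function.update c a k)) : RecolorsOn G S β ((a, k) :: L) c :=
  ⟨h.mem_a, h.color_ne h1 h2 h3, hL⟩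

lemma exists_recolorsOn_of_two (hℓ : 6 ≤ ℓ) (h : IsPendantTriangle G S' S a b d x)
    (hβ : ProperOn G S β) (hc : ProperOn G S c) (hcβ : ∀ w ∈ S, w ≠ a → w ≠ b → c w = β w) :
    ∃ L, RecolorsOn G S β L c ∧ (∀ w, w ≠ a → w ≠ b → moveCount w L = 0) ∧
      moveCount a L ≤ 2 ∧ moveCount b L ≤ 1 := by
  have hab := h.adj_ab.ne
  have had := h.adj_ad.ne
  have hbd := h.adj_bd.ne
  have hax := h.adj_ax.ne
  have hbx := h.adj_bx.ne
  have hdx := h.adj_dx.ne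
  have hd := hcβ d h.swap'.swap.mem_a had.symm hbd.symm
  have hx := hcβ x h.mem_x hax.symm hbx.symm
  obtain ⟨β1, β2, β3, β4, β5, β6⟩ := h.pairwise_ne hβ
  obtain ⟨c1, c2, c3, c4, c5, c6⟩ := h.pairwise_ne hc
  by_cases h1 : β a = c b
  · by_cases h2 : β b = c a
    · obtain ⟨k, hk⟩ := exists_notMem_of_length_lt [c a, c b, c d, c x] (by simp; omega)
      simp only [List.mem_cons, not_or] at hk
      obtain ⟨k1, k2, k3, k4, -⟩ := hk
      refine ⟨[(a, k), (b, β b), (a, β a)], h.recolorsOn_cons ?_ ?_ ?_ (h.swap.recolorsOn_cons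
        ?_ ?_ ?_ (h.recolorsOn_cons ?_ ?_ ?_ ?_)), ?_, ?_, ?_⟩
      case refine_10 => intro w hw; grind
      all_goals grind [moveCount_cons, moveCount_nil]
    · refine ⟨[(b, β b), (a, β a)], h.swap.recolorsOn_cons ?_ ?_ ?_
        (h.recolorsOn_cons ?_ ?_ ?_ ?_), ?_, ?_, ?_⟩
      case refine_7 => intro w hw; grind
      all_goals grind [moveCount_cons, moveCount_nil]
  · refine ⟨[(a, β a), (b, β b)], h.recolorsOn_cons ?_ ?_ ?_
      (h.swap.recolorsOn_cons ?_ ?_ ?_ ?_), ?_, ?_, ?_⟩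
    case refine_7 => intro w hw; grind
    all_goals grind [moveCount_cons, moveCount_nil]

/-- The case in which no vertex of the triangle can be recolored at once. -/
lemma exists_recolorsOn_of_cycle (hℓ : 6 ≤ ℓ) (h : IsPendantTriangle G S' S a b d x)
    (hβ : ProperOn G S β) (hc : ProperOn G S c)
    (hcβ : ∀ w ∈ S, w ≠ a → w ≠ b → w ≠ d → c w = β w)
    (ha : β a = c d) (hb : β b = c a) (hd : β d = c b) :
    ∃ L, RecolorsOn G S β L c ∧ (∀ w, w ≠ a → w ≠ b → w ≠ d → moveCount w L = 0) ∧
      moveCount a L ≤ 1 ∧ moveCount b L ≤ 2 ∧ moveCount d L ≤ 2 := by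
  have hab := h.adj_ab.ne
  have had := h.adj_ad.ne
  have hbd := h.adj_bd.ne
  have hax := h.adj_ax.ne
  have hbx := h.adj_bx.ne
  have hdx := h.adj_dx.ne
  have hx := hcβ x h.mem_x hax.symm hbx.symm hdx.symm
  obtain ⟨β1, β2, β3, β4, β5, β6⟩ := h.pairwise_ne hβ
  obtain ⟨c1, c2, c3, c4, c5, c6⟩ := h.pairwise_ne hc
  obtain ⟨k, hk⟩ := exists_notMem_of_length_lt [c a, c b, c d, c x] (by simp; omega)
  simp only [List.mem_cons, not_or] at hk
  obtain ⟨k1, k2, k3, k4, -⟩ := hk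
  refine ⟨[(b, k), (d, β d), (a, β a), (b, β b)], h.swap.recolorsOn_cons ?_ ?_ ?_
    (h.swap'.swap.recolorsOn_cons ?_ ?_ ?_ (h.recolorsOn_cons ?_ ?_ ?_
    (h.swap.recolorsOn_cons ?_ ?_ ?_ ?_))), ?_, ?_, ?_, ?_⟩
  case refine_13 => intro w hw; grind
  all_goals grind [moveCount_cons, moveCount_nil]

/-- A triangle vertex whose final color is available is recolored first. -/
lemma exists_recolorsOn_of_avail (hℓ : 6 ≤ ℓ) (h : IsPendantTriangle G S' S a b d x)
    (hβ : ProperOn G S β) (hc : ProperOn G S c)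
    (hcβ : ∀ w ∈ S, w ≠ a → w ≠ b → w ≠ d → c w = β w)
    (hab : c b ≠ β a) (had : c d ≠ β a) :
    ∃ L, RecolorsOn G S β L c ∧ (∀ w, w ≠ a → w ≠ b → w ≠ d → moveCount w L = 0) ∧
      moveCount a L ≤ 1 ∧ moveCount b L ≤ 2 ∧ moveCount d L ≤ 1 := by
  have hx := hcβ x h.mem_x h.adj_ax.ne' h.adj_bx.ne' h.adj_dx.ne'
  have hax : c x ≠ β a := by rw [hx]; exact (hβ _ h.mem_a _ h.mem_x h.adj_ax).symm
  obtain ⟨L, h1, h2, h3, h4⟩ := h.swap.swap'.exists_recolorsOn_of_two hℓ hβ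
    (hc.update (h.color_ne hab had hax)) (fun w hw hwb hwd => by
      by_cases e : w = a
      · subst e; simp
      · simpa [e] using hcβ w hw e hwb hwd)
  have hne1 := h.adj_ab.ne
  have hne2 := h.adj_ad.ne
  refine ⟨_, h.recolorsOn_cons hab had hax h1, fun w ha hb hd => ?_, ?_, ?_, ?_⟩
  · simp [h2 w hb hd, Ne.symm ha]
  · simp [h2 a hne1 hne2]
  · simpa [hne1] using h3
  · simpa [hne2] using h4

/-- When all other vertices have their final color, the triangle can be finished by recoloring
`a` at most once and `b` and `d` at most twice. -/
lemma exists_recolorsOn_of_three (hℓ : 6 ≤ ℓ) (h : IsPendantTriangle G S' S a b d x)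
    (hβ : ProperOn G S β) (hc : ProperOn G S c)
    (hcβ : ∀ w ∈ S, w ≠ a → w ≠ b → w ≠ d → c w = β w) :
    ∃ L, RecolorsOn G S β L c ∧ (∀ w, w ≠ a → w ≠ b → w ≠ d → moveCount w L = 0) ∧
      moveCount a L ≤ 1 ∧ moveCount b L ≤ 2 ∧ moveCount d L ≤ 2 := by
  by_cases ha : c b ≠ β a ∧ c d ≠ β a
  · obtain ⟨L, h1, h2, h3, h4, h5⟩ := h.exists_recolorsOn_of_avail hℓ hβ hc hcβ ha.1 ha.2
    exact ⟨L, h1, h2, h3, h4, by omega⟩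
  by_cases hb : c d ≠ β b ∧ c a ≠ β b
  · obtain ⟨L, h1, h2, h3, h4, h5⟩ := h.swap.swap'.exists_recolorsOn_of_avail hℓ hβ hc
      (fun w hw h1 h2 h3 => hcβ w hw h3 h1 h2) hb.1 hb.2
    exact ⟨L, h1, fun w h3 h4 h5 => h2 w h4 h5 h3, h5, by omega, h4⟩
  by_cases hd : c b ≠ β d ∧ c a ≠ β d
  · obtain ⟨L, h1, h2, h3, h4, h5⟩ := h.swap'.swap.swap'.exists_recolorsOn_of_avail hℓ hβ hc
      (fun w hw h1 h2 h3 => hcβ w hw h3 h2 h1) hd.1 hd.2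
    exact ⟨L, h1, fun w h3 h4 h5 => h2 w h5 h4 h3, h5, h4, by omega⟩
  obtain ⟨β1, β2, β3, -, -, -⟩ := h.pairwise_ne hβ
  have : (β a = c d ∧ β b = c a ∧ β d = c b) ∨ (β a = c b ∧ β d = c a ∧ β b = c d) := by
    grind
  rcases this with ⟨h1, h2, h3⟩ | ⟨h1, h2, h3⟩
  · exact h.exists_recolorsOn_of_cycle hℓ hβ hc hcβ h1 h2 h3
  · obtain ⟨L, h1, h2, h3, h4, h5⟩ := h.swap'.exists_recolorsOn_of_cycle hℓ hβ hc
      (fun w hw h1 h2 h3 => hcβ w hw h1 h3 h2) h1 h2 h3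
    exact ⟨L, h1, fun w h3 h4 h5 => h2 w h3 h5 h4, h3, h5, h4⟩

end IsPendantTriangle

/-- The recoloring `L` starting at `c` can be extended to the triangle `abd` of `S` in such a way
that each vertex `v` of the triangle is recolored at most `p v` times. -/
def ExtendsToTriangle (G : SimpleGraph V) (S : Finset V) (β : V → Fin ℓ) (a b d : V) (p : V → ℕ)
    (L : List (V × Fin ℓ)) (c : V → Fin ℓ) : Prop :=
  ∃ L', RecolorsOn G S β L' c ∧
    (∀ w, ¬ (w = a ∨ w = b ∨ w = d) → moveCount w L' = moveCount w L) ∧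
    ∀ v, v = a ∨ v = b ∨ v = d → moveCount v L' ≤ p v

namespace IsPendantTriangle

variable {a b d x : V} {p : V → ℕ} {L : List (V × Fin ℓ)}

lemma extends_cons (h : IsPendantTriangle G S' S a b d x) {v : V} {k : Fin ℓ} (hv : v ∈ S')
    (hk : ∀ w ∈ S, G.Adj v w → c w ≠ k)
    (hL : ExtendsToTriangle G S β a b d p L (Function.update c v k)) :
    ExtendsToTriangle G S β a b d p ((v, k) :: L) c := by
  obtain ⟨L', h1, h2, h3⟩ := hL
  refine ⟨(v, k) :: L', ⟨h.subset hv, hk, h1⟩, fun w hw => by simp [h2 w hw], fun w hw => ?_⟩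
  have : v ≠ w := by rintro rfl; exact h.notMem_of_eq hw hv
  simpa [this] using h3 w hw

lemma extends_move {v : V} {k : Fin ℓ} (hvS : v ∈ S)
    (hv : v = a ∨ v = b ∨ v = d) (hpv : 1 ≤ p v) (hk : ∀ w ∈ S, G.Adj v w → c w ≠ k)
    (hL : ExtendsToTriangle G S β a b d (Function.update p v (p v - 1)) L
      (Function.update c v k)) :
    ExtendsToTriangle G S β a b d p L c := by
  obtain ⟨L', h1, h2, h3⟩ := hL
  refine ⟨(v, k) :: L', ⟨hvS, hk, h1⟩, fun w hw => ?_, fun w hw => ?_⟩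
  · have : v ≠ w := by rintro rfl; exact hw hv
    simp [h2 w hw, this]
  · have := h3 w hw
    by_cases e : v = w
    · subst e
      simp only [Function.update_self] at this
      simp only [moveCount_cons, if_true]
      omega
    · simpa [e, Function.update_of_ne (Ne.symm e)] using this

/-- Before `x` receives the color `k`, the triangle vertex of color `k`, if there is one, is
recolored with a color different from a prescribed color `k'`. -/
lemma extends_step (hℓ : 6 ≤ ℓ) (h : IsPendantTriangle G S' S a b d x) {k : Fin ℓ} (k' : Fin ℓ)
    (hc : ProperOn G S c) (hL : RecolorsOn G S' β ((x, k) :: L) c) :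
    ∃ c', ProperOn G S c' ∧ RecolorsOn G S' β L c' ∧
      ((∀ p, ExtendsToTriangle G S β a b d p L c' →
          ExtendsToTriangle G S β a b d p ((x, k) :: L) c) ∨
        ∃ v, (v = a ∨ v = b ∨ v = d) ∧ c v = k ∧ c' v ≠ k' ∧ ∀ p : V → ℕ, 1 ≤ p v →
          ExtendsToTriangle G S β a b d (Function.update p v (p v - 1)) L c' →
          ExtendsToTriangle G S β a b d p ((x, k) :: L) c) := by
  obtain ⟨-, hk, hL⟩ := hL
  dsimp only at hk hL
  have hxk : ∀ c' : V → Fin ℓ, (∀ w ∈ S', c' w = c w) →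
      (∀ v, (v = a ∨ v = b ∨ v = d) → c' v ≠ k) → ∀ w ∈ S, G.Adj x w → c' w ≠ k := by
    intro c' h1 h2 w hw hadj
    by_cases hwT : w = a ∨ w = b ∨ w = d
    · exact h2 w hwT
    · have hwS' : w ∈ S' := by have := (h.mem_S w).1 hw; tauto
      rw [h1 w hwS']
      exact hk w hwS' hadj
  by_cases hT : ∃ v, (v = a ∨ v = b ∨ v = d) ∧ c v = k
  · obtain ⟨v, hv, rfl⟩ := hT
    obtain ⟨b', d', h', hiff⟩ := h.exists_rotation hv
    obtain ⟨f, hf⟩ := exists_notMem_of_length_lt [c v, c b', c d', c x, k'] (by simp; omega)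
    simp only [List.mem_cons, not_or] at hf
    obtain ⟨f1, f2, f3, f4, f5, -⟩ := hf
    have hfree := h'.color_ne (Ne.symm f2) (Ne.symm f3) (Ne.symm f4)
    obtain ⟨c1, c2, -, -, -, -⟩ := h'.pairwise_ne hc
    have hfree' : ∀ w ∈ S, G.Adj x w → Function.update c v f w ≠ c v := by
      apply hxk
      · intro w hw
        have : w ≠ v := by rintro rfl; exact h'.ha hw
        simp [this]
      · intro w hw
        rcases (hiff w).2 hw with rfl | rfl | rfl
        · simpa using f1
        · rw [Function.update_of_ne h'.adj_ab.ne']; exact c1.symm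
        · rw [Function.update_of_ne h'.adj_ad.ne']; exact c2.symm
    refine ⟨_, (hc.update hfree).update hfree', hL.congr fun w hw => ?_, Or.inr
      ⟨v, hv, rfl, ?_, fun p hp hE => ?_⟩⟩
    · have : w ≠ v := by rintro rfl; exact h'.ha hw
      rw [Function.update_comm h'.a_ne_x, Function.update_of_ne this]
    · rw [Function.update_of_ne h'.a_ne_x, Function.update_self]
      exact f5
    · exact extends_move h'.mem_a hv hp hfree (h.extends_cons h.hx hfree' hE)
  · push Not at hT
    have hfree := hxk c (fun _ _ => rfl) hT
    exact ⟨_, hc.update hfree, hL, Or.inl fun p hE => h.extends_cons h.hx hfree hE⟩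

/-- To extend a recoloring to the triangle, only the recolorings of `x` need attention. -/
lemma extends_induction (h : IsPendantTriangle G S' S a b d x)
    (C : List (V × Fin ℓ) → (V → Fin ℓ) → Prop)
    (hnil : ∀ c, ProperOn G S c → RecolorsOn G S' β [] c →
      ExtendsToTriangle G S β a b d p [] c)
    (hx : ∀ k L c, ProperOn G S c → RecolorsOn G S' β ((x, k) :: L) c → C ((x, k) :: L) c →
      ExtendsToTriangle G S β a b d p ((x, k) :: L) c)
    (hC : ∀ v k L c, v ∈ S' → v ≠ x → C ((v, k) :: L) c → C L (Function.update c v k))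
    (L : List (V × Fin ℓ)) (c : V → Fin ℓ) (hc : ProperOn G S c) (hL : RecolorsOn G S' β L c)
    (hCL : C L c) : ExtendsToTriangle G S β a b d p L c := by
  induction L generalizing c with
  | nil => exact hnil c hc hL
  | cons m L ih =>
    obtain ⟨v, k⟩ := m
    by_cases hvx : v = x
    · subst hvx
      exact hx k L c hc hL hCL
    · obtain ⟨hv, hk, hL⟩ := hL
      dsimp only at hv hk hL
      have hfree : ∀ w ∈ S, G.Adj v w → c w ≠ k := by
        intro w hw hadj
        by_cases hwT : w = a ∨ w = b ∨ w = d
        · exfalso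
          obtain ⟨b', d', h', hiff⟩ := h.exists_rotation hwT
          rcases h'.nbr_a v (h.subset hv) hadj.symm with e | e | e
          · exact h'.hb (e ▸ hv)
          · exact h'.hd (e ▸ hv)
          · exact hvx e
        · exact hk w (by have := (h.mem_S w).1 hw; tauto) hadj
      exact h.extends_cons hv hfree (ih _ (hc.update hfree) hL (hC v k L c hv hvx hCL))

lemma extends_of_no_move (hℓ : 6 ≤ ℓ) (h : IsPendantTriangle G S' S a b d x)
    (hβ : ProperOn G S β) {u : V} (hu : u = a ∨ u = b ∨ u = d) (hpu : 1 ≤ p u)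
    (hp : ∀ v, v = a ∨ v = b ∨ v = d → v ≠ u → 2 ≤ p v)
    (L : List (V × Fin ℓ)) (c : V → Fin ℓ) (hc : ProperOn G S c) (hL : RecolorsOn G S' β L c)
    (hx : (newColors (· = x) L).length ≤ 0) : ExtendsToTriangle G S β a b d p L c := by
  refine h.extends_induction (fun L _ => (newColors (· = x) L).length ≤ 0) ?_ ?_ ?_ L c hc hL hx
  · intro c hc hnil
    obtain ⟨b', d', h', hiff⟩ := h.exists_rotation hu
    obtain ⟨L, h1, h2, h3, h4, h5⟩ := h'.exists_recolorsOn_of_three hℓ hβ hc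
      (fun w hw h1 h2 h3 => hnil w (by have := (h'.mem_S w).1 hw; tauto))
    refine ⟨L, h1, fun w hw => ?_, fun v hv => ?_⟩
    · have := hiff w
      exact h2 w (by tauto) (by tauto) (by tauto)
    · rcases (hiff v).2 hv with rfl | rfl | rfl
      · omega
      · have := hp v hv h'.adj_ab.ne'; omega
      · have := hp v hv h'.adj_ad.ne'; omega
  · intro k L c _ _ hC
    simp [newColors_cons] at hC
  · intro v k L c _ hvx hC
    simpa [newColors_cons, hvx] using hC

lemma extends_of_one_move (hℓ : 6 ≤ ℓ) (h : IsPendantTriangle G S' S a b d x)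
    (hβ : ProperOn G S β) (hp : ∀ v, v = a ∨ v = b ∨ v = d → 2 ≤ p v)
    (L : List (V × Fin ℓ)) (c : V → Fin ℓ) (hc : ProperOn G S c) (hL : RecolorsOn G S' β L c)
    (hx : (newColors (· = x) L).length ≤ 1) : ExtendsToTriangle G S β a b d p L c := by
  have h0 : ∀ L c, ProperOn G S c → RecolorsOn G S' β L c →
      (newColors (· = x) L).length ≤ 0 → ExtendsToTriangle G S β a b d p L c :=
    h.extends_of_no_move hℓ hβ (Or.inl rfl) (by have := hp a (by simp); omega) fun v hv _ => hp v hv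
  refine h.extends_induction (fun L _ => (newColors (· = x) L).length ≤ 1)
    (fun c hc hL => h0 _ c hc hL (by simp)) ?_ ?_ L c hc hL hx
  · intro k L c hc hL hC
    rw [newColors_cons, if_pos rfl, List.length_cons] at hC
    obtain ⟨c', hc', hL', hE | ⟨v, hv, hck, -, hE⟩⟩ := h.extends_step hℓ k hc hL
    · exact hE p (h0 _ _ hc' hL' (by omega))
    · have hpv := hp v hv
      refine hE p (by omega) (h.extends_of_no_move hℓ hβ hv ?_ ?_ _ _ hc' hL' (by omega))
      · rw [Function.update_self]; omega
      · intro w hw hwv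
        rw [Function.update_of_ne hwv]
        exact hp w hw
  · intro v k L c _ hvx hC
    simpa [newColors_cons, hvx] using hC

lemma extends_of_two_moves (hℓ : 6 ≤ ℓ) (h : IsPendantTriangle G S' S a b d x)
    (hβ : ProperOn G S β) (hp : ∀ v, v = a ∨ v = b ∨ v = d → 2 ≤ p v)
    (L : List (V × Fin ℓ)) (c : V → Fin ℓ) (hc : ProperOn G S c) (hL : RecolorsOn G S' β L c)
    (hx : (newColors (· = x) L).length ≤ 2)
    (hhead : ∀ v, v = a ∨ v = b ∨ v = d → (newColors (· = x) L).head? = some (c v) → 3 ≤ p v) :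
    ExtendsToTriangle G S β a b d p L c := by
  refine h.extends_induction (fun L c => (newColors (· = x) L).length ≤ 2 ∧
    ∀ v, v = a ∨ v = b ∨ v = d → (newColors (· = x) L).head? = some (c v) → 3 ≤ p v)
    (fun c hc hL => h.extends_of_one_move hℓ hβ hp _ c hc hL (by simp)) ?_ ?_ L c hc hL ⟨hx, hhead⟩
  · rintro k L c hc hL ⟨hC, hhead⟩
    rw [newColors_cons, if_pos rfl] at hC hhead
    rw [List.length_cons] at hC
    obtain ⟨c', hc', hL', hE | ⟨v, hv, hck, -, hE⟩⟩ := h.extends_step hℓ k hc hL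
    · exact hE p (h.extends_of_one_move hℓ hβ hp _ _ hc' hL' (by omega))
    · have hpv := hhead v hv (by simp [hck])
      refine hE p (by omega) (h.extends_of_one_move hℓ hβ ?_ _ _ hc' hL' (by omega))
      intro w hw
      by_cases e : w = v
      · subst e; rw [Function.update_self]; omega
      · rw [Function.update_of_ne e]; exact hp w hw
  · rintro v k L c hv hvx ⟨hC, hhead⟩
    rw [newColors_cons, if_neg hvx] at hC hhead
    refine ⟨hC, fun w hw hwc => hhead w hw ?_⟩
    have : w ≠ v := by rintro rfl; exact h.notMem_of_eq hw hv
    rwa [Function.update_of_ne this] at hwc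

lemma extends_of_three_moves (hℓ : 6 ≤ ℓ) (h : IsPendantTriangle G S' S a b d x)
    (hβ : ProperOn G S β) (L : List (V × Fin ℓ)) (c : V → Fin ℓ) (hc : ProperOn G S c)
    (hL : RecolorsOn G S' β L c) (hx : (newColors (· = x) L).length ≤ 3) :
    ExtendsToTriangle G S β a b d (fun _ => 3) L c := by
  refine h.extends_induction (fun L _ => (newColors (· = x) L).length ≤ 3)
    (fun c hc hL => h.extends_of_one_move hℓ hβ (by simp) _ c hc hL (by simp)) ?_ ?_ L c hc hL hx
  · intro k L c hc hL hC
    rw [newColors_cons, if_pos rfl, List.length_cons] at hC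
    obtain ⟨c', hc', hL', hE | ⟨v, hv, hck, hk', hE⟩⟩ :=
      h.extends_step hℓ ((newColors (· = x) L).head?.getD k) hc hL
    · exact hE _ (h.extends_of_two_moves hℓ hβ (by simp) _ _ hc' hL' (by omega) (by simp))
    · refine hE _ (by simp) (h.extends_of_two_moves hℓ hβ ?_ _ _ hc' hL' (by omega) ?_)
      · intro w hw
        by_cases e : w = v
        · subst e; simp
        · simp [e]
      · intro w hw hhead
        by_cases e : w = v
        · subst e; simp [hhead] at hk'
        · simp [e]
  · intro v k L c _ hvx hC
    simpa [newColors_cons, hvx] using hC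

end IsPendantTriangle

lemma length_newColors_le {P : V → Prop} [DecidablePred P] {p q : V} (L : List (V × Fin ℓ))
    (hL : ∀ m ∈ L, P m.1 → m.1 = p ∨ m.1 = q) :
    (newColors P L).length ≤ moveCount p L + moveCount q L := by
  induction L with
  | nil => simp
  | cons m L ih =>
    have := ih fun m hm => hL m (List.mem_cons_of_mem _ hm)
    rw [newColors_cons, moveCount_cons, moveCount_cons]
    by_cases hP : P m.1
    · rw [if_pos hP, List.length_cons]
      rcases hL m (by simp) hP with e | e <;> simp only [e, if_true] <;> split_ifs <;> omega
    · rw [if_neg hP]; omega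

lemma RecolorsOn.mem {L : List (V × Fin ℓ)} (h : RecolorsOn G S β L c) : ∀ m ∈ L, m.1 ∈ S := by
  induction L generalizing c with
  | nil => simp
  | cons m L ih =>
    obtain ⟨h1, -, h3⟩ := h
    simpa [h1] using fun v k hm => ih h3 (v, k) hm

/-- The recoloring of the subgraph induced by `S`. -/
lemma exists_recolorsOn (hG : ¬ IsMinor (completeBipartiteGraph (Fin 2) (Fin 3)) G) (hℓ : 6 ≤ ℓ)
    (S : Finset V) (hβ : ProperOn G S β) (hc : ProperOn G S c) :
    ∃ L, RecolorsOn G S β L c ∧ ∀ v, moveCount v L ≤ 3 := by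
  classical
  induction S using Finset.strongInduction with
  | H S ih =>
    rcases S.eq_empty_or_nonempty with rfl | hS
    · exact ⟨[], by simp [RecolorsOn], by simp⟩
    by_cases hdeg : ∀ v ∈ S, ∀ p q, ∃ w ∈ S, G.Adj v w ∧ w ≠ p ∧ w ≠ q
    · obtain ⟨a, ha, b, hb, d, hd, x, hx, hab, had, hbd, hax, hbx, hdx, hNa, hNb, hNd⟩ :=
        exists_pendant_triangle hG hS hdeg
      have h : IsPendantTriangle G (S \ {a, b, d}) S a b d x :=
        { adj_ab := hab, adj_ad := had, adj_bd := hbd, adj_ax := hax, adj_bx := hbx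
          adj_dx := hdx, subset := Finset.sdiff_subset
          mem_S := fun w => by
            simp only [Finset.mem_sdiff, Finset.mem_insert, Finset.mem_singleton]
            constructor
            · tauto
            · rintro (rfl | rfl | rfl | ⟨h, -⟩) <;> assumption
          ha := by simp
          hb := by simp
          hd := by simp
          hx := by simp [hx, hax.ne', hbx.ne', hdx.ne']
          nbr_a := hNa, nbr_b := hNb, nbr_d := hNd }
      obtain ⟨L, hL, hcount⟩ := ih (S \ {a, b, d})
        (Finset.ssubset_iff_subset_ne.2 ⟨h.subset, fun e => h.ha (by rw [e]; exact ha)⟩)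
        (hβ.mono h.subset) (hc.mono h.subset)
      obtain ⟨L', h1, h2, h3⟩ := h.extends_of_three_moves hℓ hβ L c hc hL
        (by rw [length_newColors_eq]; exact hcount x)
      refine ⟨L', h1, fun v => ?_⟩
      by_cases hv : v = a ∨ v = b ∨ v = d
      · exact h3 v hv
      · rw [h2 v hv]; exact hcount v
    · push Not at hdeg
      obtain ⟨v, hv, p, q, hpq⟩ := hdeg
      obtain ⟨L, hL, hcount⟩ := ih (S.erase v) (Finset.erase_ssubset hv)
        (hβ.mono (Finset.erase_subset _ _)) (hc.mono (Finset.erase_subset _ _))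
      have hN : ∀ w ∈ S.erase v, G.Adj v w → w = p ∨ w = q := fun w hw hadj => by
        have := hpq w (Finset.mem_of_mem_erase hw) hadj
        tauto
      have hlen := length_newColors_le (P := G.Adj v) L fun m hm hadj => hN _ (hL.mem m hm) hadj
      have hp := hcount p
      have hq := hcount q
      obtain ⟨L', h1, h2, h3⟩ := exists_recolorsOn_insert hℓ (Finset.notMem_erase v S) hN
        (by rwa [Finset.insert_erase hv]) L c 0 hL (by rwa [Finset.insert_erase hv]) (by simp)
      rw [Finset.insert_erase hv] at h1
      refine ⟨L', h1, fun w => ?_⟩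
      by_cases hw : w = v
      · subst hw; omega
      · rw [h2 w hw]; exact hcount w

/-- A list of recolorings yields a transformation, by dropping the steps without effect. -/
lemma RecolorsOn.exists_isTransformSeq [Fintype V] {L : List (V × Fin ℓ)}
    (h : RecolorsOn G Finset.univ β L c) (hc : IsProperColoring G c) :
    ∃ (m : ℕ) (s : Fin (m + 1) → V → Fin ℓ),
      IsTransformSeq G s c β ∧ ∀ v, RecolorCount s v ≤ moveCount v L := by
  induction L generalizing c with
  | nil =>
    obtain rfl : c = β := funext fun v => h v (Finset.mem_univ v)
    exact ⟨0, fun _ => c, ⟨rfl, rfl, fun _ => hc, fun i => i.elim0⟩,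
      fun v => by simp [RecolorCount]⟩
  | cons m L ih =>
    obtain ⟨v, k⟩ := m
    obtain ⟨-, hk, hL⟩ := h
    dsimp only at hk hL
    by_cases hcv : c v = k
    · rw [← hcv, Function.update_eq_self] at hL
      obtain ⟨m, s, hs, hcount⟩ := ih hL hc
      exact ⟨m, s, hs, fun u => (hcount u).trans (by simp)⟩
    · have hc' : IsProperColoring G (Function.update c v k) := by
        have hp : ProperOn G Finset.univ c := fun u _ w _ hadj => hc hadj
        exact fun u w hadj => hp.update hk u (Finset.mem_univ _) w (Finset.mem_univ _) hadj
      obtain ⟨m, s, ⟨h0, hlast, hprop, hstep⟩, hcount⟩ := ih hL hc'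
      refine ⟨m + 1, Fin.cons c s, ⟨rfl, ?_, ?_, ?_⟩, fun u => ?_⟩
      · rw [← Fin.succ_last, Fin.cons_succ]; exact hlast
      · intro i
        refine Fin.cases ?_ (fun i => ?_) i
        · exact hc
        · exact hprop i
      · intro i
        refine Fin.cases ?_ (fun i => ?_) i
        · refine ⟨v, ?_, fun w hw => ?_⟩
          · simpa [h0] using hcv
          · by_contra hwv
            simp [h0, hwv] at hw
        · exact hstep i
      · have := hcount u
        unfold RecolorCount at this ⊢
        rw [Finset.card_filter] at this ⊢
        rw [Fin.sum_univ_succ, moveCount_cons, add_comm]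
        refine add_le_add this ?_
        by_cases e : v = u
        · simp [e]; split_ifs <;> simp
        · simp [h0, e, Function.update_of_ne (Ne.symm e)]

end Recoloring

theorem k23_minor_free_recolor_six_colors
    {V : Type} [Fintype V] (G : SimpleGraph V)
    (hG : ¬ IsMinor (completeBipartiteGraph (Fin 2) (Fin 3)) G)
    (ℓ : ℕ) (hℓ : 6 ≤ ℓ) (α β : V → Fin ℓ)
    (hα : IsProperColoring G α) (hβ : IsProperColoring G β) :
    ∃ (m : ℕ) (c : Fin (m + 1) → V → Fin ℓ),
      IsTransformSeq G c α β ∧ ∀ v : V, RecolorCount c v ≤ 3 := by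
  classical
  obtain ⟨L, hL, hcount⟩ := exists_recolorsOn hG hℓ Finset.univ (β := β) (c := α)
    (fun v _ w _ h => hβ h) (fun v _ w _ h => hα h)
  obtain ⟨m, s, hs, hsL⟩ := hL.exists_isTransformSeq hα
  exact ⟨m, s, hs, fun v => (hsL v).trans (hcount v)⟩
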